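/- Let V ⊆ ℝ² be a simple polygon with vertices v₁,…,vₙ listed in counterclockwise order, let φ₁,…,φₙ be harmonic generalized barycentric coordinates on V, and let W ⊆ ℝ² be a convex polygon with vertices w₁,…,wₙ listed in counterclockwise order. Then the harmonic GBC map F(x) = Σᵢ₌₁ⁿ φᵢ(x)·wᵢ, restricted to the interior of V, is a smooth diffeomorphism from the interior of V onto the interior of W: it is smooth, bijective onto the interior of W, its Jacobian determinant is nonzero at every interior point, and its inverse is smooth. -/

import Mathlib

open Set Filter Topology

/-- The Laplacian `∂²u/∂x² + ∂²u/∂y²` of a function `u : ℝ² → ℝ` at a point `p`. -/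
noncomputable def lap2 (u : ℝ × ℝ → ℝ) (p : ℝ × ℝ) : ℝ :=
  fderiv ℝ (fun q => fderiv ℝ u q (1, 0)) p (1, 0) +
  fderiv ℝ (fun q => fderiv ℝ u q (0, 1)) p (0, 1)

/-- `u` is harmonic on `Ω ⊆ ℝ²`: twice continuously differentiable with vanishing Laplacian. -/
def HarmonicOn2 (u : ℝ × ℝ → ℝ) (Ω : Set (ℝ × ℝ)) : Prop :=
  ContDiffOn ℝ 2 u Ω ∧ ∀ p ∈ Ω, lap2 u p = 0

/-- The 1-periodic loop `γ` winds once counterclockwise around the point `z`: it admits a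
continuous polar-coordinate representation around `z` whose angle increases by `2π`
over one period. -/
def WindsCCWAround (γ : ℝ → ℝ × ℝ) (z : ℝ × ℝ) : Prop :=
  ∃ r θ : ℝ → ℝ, Continuous r ∧ Continuous θ ∧ (∀ t, 0 < r t) ∧
    (∀ t, γ t - z = (r t * Real.cos (θ t), r t * Real.sin (θ t))) ∧
    (∀ t, θ (t + 1) = θ t + 2 * Real.pi)

/-- `γ` is a counterclockwise Jordan parametrization of the boundary of `V`: a 1-periodic
continuous loop, injective on a period, whose image is `frontier V`, and which winds once
counterclockwise around every interior point of `V`. -/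
def IsCCWBoundaryParam (γ : ℝ → ℝ × ℝ) (V : Set (ℝ × ℝ)) : Prop :=
  Continuous γ ∧ (∀ t, γ (t + 1) = γ t) ∧ InjOn γ (Ico (0 : ℝ) 1) ∧
  γ '' Ico (0 : ℝ) 1 = frontier V ∧ ∀ z ∈ interior V, WindsCCWAround γ z

/-- `γ` is a counterclockwise piecewise-linear parametrization of the boundary of `V`
through the vertices `v 0, …, v (n-1)` (the vertex list `v` is read cyclically). -/
def IsPolygonalCCWParam (γ : ℝ → ℝ × ℝ) (n : ℕ) (v : ℕ → ℝ × ℝ) (V : Set (ℝ × ℝ)) : Prop :=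
  IsCCWBoundaryParam γ V ∧
  ∀ i : ℕ, ∀ s ∈ Icc (0 : ℝ) 1, γ ((i + s) / n) = (1 - s) • v i + s • v (i + 1)

/-- `V` is the simple polygon (compact region bounded by a simple closed polygonal curve)
with vertices `v 0, …, v (n-1)` listed in counterclockwise order. -/
def IsSimplePolygonCCW (V : Set (ℝ × ℝ)) (n : ℕ) (v : ℕ → ℝ × ℝ) : Prop :=
  3 ≤ n ∧ (∀ i, v (i + n) = v i) ∧ IsCompact V ∧ V = closure (interior V) ∧
  (interior V).Nonempty ∧ ∃ γ, IsPolygonalCCWParam γ n v V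

/-- `W` is the convex polygon with vertices `w 0, …, w (n-1)`, which lie on its boundary
in counterclockwise order. -/
def IsConvexPolygonCCW (W : Set (ℝ × ℝ)) (n : ℕ) (w : ℕ → ℝ × ℝ) : Prop :=
  (∀ i, w (i + n) = w i) ∧ W = convexHull ℝ (range w) ∧ ∃ γ, IsPolygonalCCWParam γ n w W

/-- `φ 0, …, φ (n-1)` are harmonic generalized barycentric coordinates on the polygon `V`
with vertices `v 0, …, v (n-1)`. -/
def IsHarmonicGBC (n : ℕ) (v : ℕ → ℝ × ℝ) (V : Set (ℝ × ℝ)) (φ : ℕ → (ℝ × ℝ) → ℝ) : Prop :=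
  (∀ i, ContinuousOn (φ i) V) ∧ (∀ i, HarmonicOn2 (φ i) (interior V)) ∧
  (∀ x ∈ V, ∑ i ∈ Finset.range n, φ i x = 1) ∧
  (∀ x ∈ V, ∑ i ∈ Finset.range n, φ i x • v i = x) ∧
  (∀ i, ∀ x ∈ V, 0 ≤ φ i x) ∧
  (∀ i j, ∀ s ∈ Icc (0 : ℝ) 1,
    φ i ((1 - s) • v j + s • v (j + 1)) = (1 - s) * φ i (v j) + s * φ i (v (j + 1))) ∧
  (∀ i j, i < n → j < n → φ i (v j) = if i = j then 1 else 0)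

/-- The Jacobian determinant of a map `F = (u, v) : ℝ² → ℝ²` at a point `p`:
`det [[∂u/∂x, ∂u/∂y], [∂v/∂x, ∂v/∂y]]`. -/
noncomputable def jacDet (F : ℝ × ℝ → ℝ × ℝ) (p : ℝ × ℝ) : ℝ :=
  (fderiv ℝ F p (1, 0)).1 * (fderiv ℝ F p (0, 1)).2 -
  (fderiv ℝ F p (0, 1)).1 * (fderiv ℝ F p (1, 0)).2

/-- A harmonic function with a local maximum is locally constant there. -/
theorem HarmonicAt.eventually_eq_of_isLocalMax {h : ℂ → ℝ} {z : ℂ}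
    (hh : InnerProductSpace.HarmonicAt h z) (hm : IsLocalMax h z) : ∀ᶠ w in 𝓝 z, h w = h z := by
  obtain ⟨r, hr, hball⟩ := Metric.eventually_nhds_iff_ball.1 hh.eventually
  obtain ⟨g, hg, hgh⟩ :=
    InnerProductSpace.HarmonicOnNhd.exists_analyticOnNhd_ball_re_eq (f := h) (z := z) (R := r) hball
  have hz : z ∈ Metric.ball z r := Metric.mem_ball_self hr
  have hnear : Metric.ball z r ∈ 𝓝 z := Metric.ball_mem_nhds z hr
  have hnorm : ∀ w ∈ Metric.ball z r, ‖Complex.exp (g w)‖ = Real.exp (h w) := fun w hw => by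
    rw [Complex.norm_exp]; exact congrArg Real.exp (hgh hw)
  have hmax : IsLocalMax (norm ∘ fun w => Complex.exp (g w)) z := by
    filter_upwards [hm, hnear] with w hw hwb
    simp only [Function.comp_apply]
    rw [hnorm w hwb, hnorm z hz]
    exact Real.exp_le_exp.2 hw
  have hd : ∀ᶠ w in 𝓝 z, DifferentiableAt ℂ (fun w => Complex.exp (g w)) w := by
    filter_upwards [hnear] with w hw
    exact (hg w hw).differentiableAt.cexp
  filter_upwards [Complex.eventually_eq_of_isLocalMax_norm hd hmax, hnear] with w hw hwb
  have := congrArg norm hw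
  rw [hnorm w hwb, hnorm z hz] at this
  exact Real.exp_injective this

/-- The weak maximum principle on a bounded open set. -/
theorem harmonic_nonpos_of_frontier {O : Set ℂ} (hO : IsOpen O) (hb : Bornology.IsBounded O)
    {h : ℂ → ℝ} (hc : ContinuousOn h (closure O)) (hh : InnerProductSpace.HarmonicOnNhd h O)
    (hf : ∀ z ∈ frontier O, h z ≤ 0) : ∀ z ∈ O, h z ≤ 0 := by
  by_contra! hne
  obtain ⟨z₀, hz₀, hpos⟩ := hne
  have hK : IsCompact (closure O) := hb.isCompact_closure
  obtain ⟨z₁, hz₁, hmax⟩ := hK.exists_isMaxOn ⟨z₀, subset_closure hz₀⟩ hc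
  have hM : 0 < h z₁ := hpos.trans_le (hmax (subset_closure hz₀))
  have hS : IsCompact (closure O ∩ h ⁻¹' {h z₁}) :=
    hK.of_isClosed_subset (hc.preimage_isClosed_of_isClosed isClosed_closure isClosed_singleton)
      inter_subset_left
  obtain ⟨z₂, ⟨hz₂, hz₂M⟩, hre⟩ := hS.exists_isMaxOn ⟨z₁, hz₁, rfl⟩
    Complex.continuous_re.continuousOn
  have hz₂M : h z₂ = h z₁ := hz₂M
  have hz₂O : z₂ ∈ O := by
    by_contra hn
    have := hf z₂ ⟨hz₂, by rwa [hO.interior_eq]⟩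
    linarith
  have hloc : IsLocalMax h z₂ := by
    filter_upwards [hO.mem_nhds hz₂O] with w hw
    rw [hz₂M]; exact hmax (subset_closure hw)
  have hev := (HarmonicAt.eventually_eq_of_isLocalMax (hh z₂ hz₂O) hloc).and (hO.mem_nhds hz₂O)
  obtain ⟨ε, hε, hball⟩ := Metric.eventually_nhds_iff_ball.1 hev
  have hmem : z₂ + ((ε / 2 : ℝ) : ℂ) ∈ Metric.ball z₂ ε := by
    simp [abs_of_pos hε, hε]
  obtain ⟨h1, h2⟩ := hball _ hmem
  have := hre (show z₂ + ((ε / 2 : ℝ) : ℂ) ∈ closure O ∩ h ⁻¹' {h z₁} from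
    ⟨subset_closure h2, by simpa [hz₂M] using h1⟩)
  simp at this
  linarith

/-- If the positive part of the boundary data is connected, then so is the positivity set. -/
theorem isPreconnected_pos_of_harmonic {V : Set ℂ} (hV : IsCompact V) {h : ℂ → ℝ}
    (hc : ContinuousOn h V) (hh : InnerProductSpace.HarmonicOnNhd h (interior V))
    (hp : IsPreconnected {z | z ∈ frontier V ∧ 0 < h z}) :
    IsPreconnected {z | z ∈ V ∧ 0 < h z} := by
  -- a relatively open piece that misses the positive boundary part is empty
  have key : ∀ A B : Set ℂ, IsOpen A → IsOpen B → {z | z ∈ V ∧ 0 < h z} ⊆ A ∪ B →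
      ¬ ({z | z ∈ V ∧ 0 < h z} ∩ (A ∩ B)).Nonempty →
      (∀ z ∈ frontier V, 0 < h z → z ∉ B) → ∀ z ∈ V, 0 < h z → z ∉ B := by
    intro A B hA hB hcov hdis hfr z hz hpos hzB
    set O : Set ℂ := {z | z ∈ interior V ∧ 0 < h z ∧ z ∈ B} with hOdef
    have hinside : ∀ z ∈ V, 0 < h z → z ∈ B → z ∈ O := fun z hz hp hb => by
      refine ⟨?_, hp, hb⟩
      by_contra hn
      exact hfr z ⟨subset_closure hz, hn⟩ hp hb
    have hO : IsOpen O := by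
      have h1 : IsOpen (interior V ∩ h ⁻¹' Ioi 0) :=
        (hc.mono interior_subset).isOpen_inter_preimage isOpen_interior isOpen_Ioi
      have : O = (interior V ∩ h ⁻¹' Ioi 0) ∩ B := by
        ext z; simp only [hOdef, mem_ofPred_eq, mem_inter_iff, mem_preimage, mem_Ioi, and_assoc]
      rw [this]; exact h1.inter hB
    have hOV : closure O ⊆ V :=
      closure_minimal (fun z hz => interior_subset hz.1) hV.isClosed
    have := harmonic_nonpos_of_frontier hO (hV.isBounded.subset (subset_closure.trans hOV))
      (hc.mono hOV) (fun z hz => hh z hz.1) (fun y hy => by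
        rw [hO.frontier_eq] at hy
        by_contra! hpos
        have hyV := hOV hy.1
        rcases hcov ⟨hyV, hpos⟩ with hyA | hyB
        · obtain ⟨w, hwA, hwO⟩ := mem_closure_iff.1 hy.1 A hA hyA
          exact hdis ⟨w, ⟨interior_subset hwO.1, hwO.2.1⟩, hwA, hwO.2.2⟩
        · exact hy.2 (hinside y hyV hpos hyB)) z (hinside z hz hpos hzB)
    linarith
  intro A B hA hB hcov hAne hBne
  by_contra hdis
  have hdis' : ¬ ({z | z ∈ V ∧ 0 < h z} ∩ (B ∩ A)).Nonempty := by rwa [inter_comm B A]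
  have hbd : (∀ z ∈ frontier V, 0 < h z → z ∉ B) ∨ (∀ z ∈ frontier V, 0 < h z → z ∉ A) := by
    by_contra! hcon
    obtain ⟨⟨b, hb, hbp, hbB⟩, ⟨a, ha, hap, haA⟩⟩ := hcon
    have hsub : {z | z ∈ frontier V ∧ 0 < h z} ⊆ {z | z ∈ V ∧ 0 < h z} :=
      fun z hz => ⟨hV.isClosed.frontier_subset hz.1, hz.2⟩
    obtain ⟨w, hw, hwAB⟩ := hp A B hA hB (hsub.trans hcov) ⟨a, ⟨ha, hap⟩, haA⟩ ⟨b, ⟨hb, hbp⟩, hbB⟩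
    exact hdis ⟨w, hsub hw, hwAB⟩
  rcases hbd with hbd | hbd
  · obtain ⟨z, hz, hzB⟩ := hBne
    exact key A B hA hB hcov hdis hbd z hz.1 hz.2 hzB
  · obtain ⟨z, hz, hzA⟩ := hAne
    exact key B A hB hA (by rwa [union_comm]) hdis' hbd z hz.1 hz.2 hzA

/-- Points in a connected set disjoint from a compact `K` are not separated by `K`: the quotient
`(z - p) / (z - q)` has a continuous logarithm on `K`. -/
theorem exists_log_div_of_isPreconnected {K C : Set ℂ} (hK : IsCompact K) (hC : IsPreconnected C)
    (hKC : Disjoint K C) {p q : ℂ} (hp : p ∈ C) (hq : q ∈ C) :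
    ∃ L : ℂ → ℂ, ContinuousOn L K ∧ ∀ z ∈ K, Complex.exp (L z) = (z - p) / (z - q) := by
  have hne : ∀ c ∈ C, ∀ z ∈ K, z - c ≠ 0 := fun c hc z hz h0 =>
    disjoint_left.1 hKC hz (by rwa [sub_eq_zero.1 h0])
  refine hC.induction₂ (fun p q => ∃ L : ℂ → ℂ, ContinuousOn L K ∧
    ∀ z ∈ K, Complex.exp (L z) = (z - p) / (z - q)) ?_ ?_ ?_ hp hq
  · intro p hp
    have hpK : p ∈ Kᶜ := fun h => disjoint_left.1 hKC h hp
    obtain ⟨ε, hε, hball⟩ := Metric.isOpen_iff.1 hK.isClosed.isOpen_compl p hpK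
    filter_upwards [mem_nhdsWithin_of_mem_nhds (Metric.ball_mem_nhds p hε), self_mem_nhdsWithin]
      with q hq hqC
    have hslit : ∀ z ∈ K, (z - q) / (z - p) ∈ Complex.slitPlane := by
      intro z hz
      have hzp : ε ≤ ‖z - p‖ := by
        by_contra! hlt
        exact hball (by rwa [Metric.mem_ball, dist_eq_norm]) hz
      have : (z - q) / (z - p) = 1 + (p - q) / (z - p) := by
        field_simp [hne p hp z hz]; ring
      rw [this]
      apply Complex.mem_slitPlane_of_norm_lt_one
      rw [norm_div, div_lt_one (hε.trans_le hzp)]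
      rw [Metric.mem_ball, dist_comm, dist_eq_norm] at hq
      exact hq.trans_le hzp
    refine ⟨fun z => -Complex.log ((z - q) / (z - p)), ?_, ?_⟩
    · refine ContinuousOn.neg (ContinuousOn.clog ?_ hslit)
      exact ContinuousOn.div (by fun_prop) (by fun_prop) (hne p hp)
    · intro z hz
      rw [Complex.exp_neg, Complex.exp_log (Complex.slitPlane_ne_zero (hslit z hz)), inv_div]
  · rintro x y w hx hy hw ⟨L, hL, hLe⟩ ⟨M, hM, hMe⟩
    refine ⟨fun z => L z + M z, hL.add hM, fun z hz => ?_⟩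
    rw [Complex.exp_add, hLe z hz, hMe z hz]
    field_simp [hne y hy z hz]
  · rintro x y hx hy ⟨L, hL, hLe⟩
    refine ⟨fun z => -L z, hL.neg, fun z hz => ?_⟩
    rw [Complex.exp_neg, hLe z hz, inv_div]

/-- A logarithm of `(z - p) / (z - q)` jumps across the broken line from `p` through `x` to `q`. -/
theorem arg_add_arg_eq_of_log {K P : Set ℂ} (hP : IsPreconnected P) (hPK : P ⊆ K) {x α β e₁ e₂ : ℂ}
    {ρ : ℝ} (hρ : 0 < ρ) (hx : x ∈ K) (hxP : x ∉ P)
    (hα : ∀ t : ℝ, 0 < t → t ≤ ρ → x + t * α ∉ P) (hβ : ∀ t : ℝ, 0 < t → t ≤ ρ → x + t * β ∉ P)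
    {L : ℂ → ℂ} (hL : ContinuousOn L K)
    (hLe : ∀ z ∈ K, Complex.exp (L z) = (z - (x + ρ * α)) / (z - (x + ρ * β)))
    (he₁ : ∀ᶠ t : ℝ in 𝓝[>] 0, x + t * e₁ ∈ P) (he₂ : ∀ᶠ t : ℝ in 𝓝[>] 0, x + t * e₂ ∈ P)
    (h₁α : -α / e₁ ∈ Complex.slitPlane) (h₁β : -e₁ / β ∈ Complex.slitPlane)
    (h₂α : -α / e₂ ∈ Complex.slitPlane) (h₂β : -e₂ / β ∈ Complex.slitPlane) :
    Complex.arg (-α / e₁) + Complex.arg (-e₁ / β) =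
      Complex.arg (-α / e₂) + Complex.arg (-e₂ / β) := by
  set p := x + ρ * α with hp
  set q := x + ρ * β with hq
  have hzx : ∀ z ∈ P, z - x ≠ 0 := fun z hz h0 => hxP (by rwa [← sub_eq_zero.1 h0])
  have hzq : ∀ z ∈ P, z - q ≠ 0 := fun z hz h0 => hβ ρ hρ le_rfl (by rwa [← hq, ← sub_eq_zero.1 h0])
  have aux : ∀ d : ℂ, (∀ t : ℝ, 0 < t → t ≤ ρ → x + t * d ∉ P) → ∀ z ∈ P,
      (z - (x + ρ * d)) / (z - x) ∈ Complex.slitPlane := by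
    intro d hd z hz
    by_contra hns
    rw [Complex.mem_slitPlane_iff_not_le_zero, not_not] at hns
    obtain ⟨hre, him⟩ := Complex.le_def.1 hns
    set s : ℝ := -((z - (x + ρ * d)) / (z - x)).re with hs
    have hs0 : 0 ≤ s := by simp only [Complex.zero_re] at hre; linarith
    have hval : (z - (x + ρ * d)) / (z - x) = -(s : ℂ) := by
      apply Complex.ext
      · simp [hs]
      · simpa using him
    rw [div_eq_iff (hzx z hz)] at hval
    have h1s : (1 + s : ℂ) ≠ 0 := by exact_mod_cast (by positivity : (1 + s : ℝ) ≠ 0)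
    refine hd (ρ / (1 + s)) (by positivity) (div_le_self hρ.le (by linarith)) ?_
    convert hz using 1
    push_cast
    field_simp
    linear_combination -hval
  have s1 := aux α hα
  have s2 : ∀ z ∈ P, (z - x) / (z - q) ∈ Complex.slitPlane := fun z hz => by
    have := aux β hβ z hz
    rw [← inv_div, Complex.mem_slitPlane_iff_arg, Complex.arg_inv]
    rw [← hq, Complex.mem_slitPlane_iff_arg] at this
    refine ⟨?_, inv_ne_zero this.2⟩
    rw [if_neg this.1]
    linarith [Complex.neg_pi_lt_arg ((z - q) / (z - x)), Real.pi_pos]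
  set M : ℂ → ℂ := fun z => Complex.log ((z - p) / (z - x)) +
    Complex.log ((z - x) / (z - q)) with hM
  have hMc : ContinuousOn M P := by
    refine ContinuousOn.add (ContinuousOn.clog ?_ s1) (ContinuousOn.clog ?_ s2)
    · exact ContinuousOn.div (by fun_prop) (by fun_prop) hzx
    · exact ContinuousOn.div (by fun_prop) (by fun_prop) hzq
  have hMe : ∀ z ∈ P, Complex.exp (M z) = (z - p) / (z - q) := fun z hz => by
    simp only [hM]
    rw [Complex.exp_add, Complex.exp_log (Complex.slitPlane_ne_zero (s1 z hz)),
      Complex.exp_log (Complex.slitPlane_ne_zero (s2 z hz))]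
    rw [div_mul_div_cancel₀ (hzx z hz)]
  obtain ⟨a, ha⟩ : P.Nonempty := by
    obtain ⟨t, ht⟩ := he₁.exists
    exact ⟨_, ht⟩
  have hexpc : Complex.exp (L a - M a) = 1 := by
    rw [Complex.exp_sub, hLe a (hPK ha), hMe a ha, div_self]
    rw [← hMe a ha]; exact Complex.exp_ne_zero _
  have heq : EqOn L (fun z => M z + (L a - M a)) P := by
    refine Complex.isCoveringMap_exp.eqOn_of_comp_eqOn hP (hL.mono hPK)
      (hMc.add continuousOn_const) ?_ ha (by ring)
    intro z hz
    apply Subtype.ext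
    simp only [Function.comp_apply]
    rw [Complex.exp_add, hexpc, mul_one, hLe z (hPK hz), hMe z hz]
  have lim : ∀ e : ℂ, (∀ᶠ t : ℝ in 𝓝[>] 0, x + t * e ∈ P) → -α / e ∈ Complex.slitPlane →
      -e / β ∈ Complex.slitPlane →
      Complex.arg (-α / e) + Complex.arg (-e / β) = (L x).im - (L a - M a).im := by
    intro e he hαe hβe
    have hline : Tendsto (fun t : ℝ => x + t * e) (𝓝[>] 0) (𝓝 x) := by
      have : Continuous (fun t : ℝ => x + t * e) := by fun_prop
      exact (this.tendsto' 0 x (by simp)).mono_left nhdsWithin_le_nhds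
    have t1 : Tendsto (fun t : ℝ => (L (x + t * e)).im - (L a - M a).im) (𝓝[>] 0)
        (𝓝 ((L x).im - (L a - M a).im)) := by
      refine Tendsto.sub_const ?_ _
      refine (Complex.continuous_im.tendsto _).comp ((hL x hx).tendsto.comp ?_)
      exact tendsto_nhdsWithin_iff.2 ⟨hline, he.mono fun t ht => hPK ht⟩
    have he0 : e ≠ 0 := by rintro rfl; simp at hαe
    have hβ0 : β ≠ 0 := by rintro rfl; simp at hβe
    have harg : ∀ r : ℝ, 0 < r → ∀ z : ℂ, Complex.arg ((r : ℂ) * z) = Complex.arg z :=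
      fun r hr z => Complex.arg_real_mul z hr
    have hc1 : ContinuousAt (fun t : ℝ => (t * e - ρ * α) / (ρ * e)) 0 := by
      refine ContinuousAt.div (by fun_prop) (by fun_prop) ?_
      exact mul_ne_zero (by exact_mod_cast hρ.ne') he0
    have hc2 : ContinuousAt (fun t : ℝ => ρ * e / (t * e - ρ * β)) 0 := by
      refine ContinuousAt.div (by fun_prop) (by fun_prop) ?_
      simp [hρ.ne', hβ0]
    have hρ0 : (ρ : ℂ) ≠ 0 := by exact_mod_cast hρ.ne'
    have v1 : (((0 : ℝ) : ℂ) * e - ρ * α) / (ρ * e) = -α / e := by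
      field_simp; push_cast; ring
    have v2 : ρ * e / (((0 : ℝ) : ℂ) * e - ρ * β) = -e / β := by
      push_cast; rw [zero_mul, zero_sub, ← mul_neg, mul_div_mul_left _ _ hρ0, div_neg, neg_div]
    have t2 : Tendsto (fun t : ℝ => Complex.arg ((t * e - ρ * α) / (ρ * e)) +
        Complex.arg (ρ * e / (t * e - ρ * β))) (𝓝[>] 0)
        (𝓝 (Complex.arg (-α / e) + Complex.arg (-e / β))) := by
      refine Tendsto.mono_left ?_ nhdsWithin_le_nhds
      refine Tendsto.add ?_ ?_
      · rw [← v1]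
        exact (Complex.continuousAt_arg (by rwa [v1])).tendsto.comp hc1.tendsto
      · rw [← v2]
        exact (Complex.continuousAt_arg (by rwa [v2])).tendsto.comp hc2.tendsto
    refine tendsto_nhds_unique (t2.congr' ?_) t1
    filter_upwards [he, self_mem_nhdsWithin] with t ht htpos
    have htpos : 0 < t := htpos
    have ht0 : (t : ℂ) ≠ 0 := by exact_mod_cast htpos.ne'
    have hz := heq ht
    simp only at hz
    rw [hz, Complex.add_im, add_sub_cancel_right]
    simp only [hM, Complex.add_im, Complex.log_im]
    have r1 : (x + t * e - p) / (x + t * e - x) =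
        ((ρ / t : ℝ) : ℂ) * ((t * e - ρ * α) / (ρ * e)) := by
      rw [hp]; push_cast; field_simp; ring
    have r2 : (x + t * e - x) / (x + t * e - q) =
        ((t / ρ : ℝ) : ℂ) * (ρ * e / (t * e - ρ * β)) := by
      have : x + t * e - q = t * e - ρ * β := by rw [hq]; ring
      rw [this]
      have : (t * e - ρ * β : ℂ) ≠ 0 := this ▸ hzq _ ht
      push_cast; field_simp; ring
    rw [r1, r2, harg _ (by positivity), harg _ (by positivity)]
  rw [lim e₁ he₁ h₁α h₁β, lim e₂ he₂ h₂α h₂β]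

/-- Near a degenerate zero, a nonconstant harmonic function looks like `Re (k (z - x) ^ m)` with
`2 ≤ m` along every ray transverse to the zero set. -/
theorem HarmonicAt.exists_order_of_critical {h : ℂ → ℝ} {x : ℂ}
    (hh : InnerProductSpace.HarmonicAt h x) (hx : h x = 0) (hd : fderiv ℝ h x = 0)
    (hne : ¬ ∀ᶠ z in 𝓝 x, h z = 0) :
    ∃ (m : ℕ) (k : ℂ), 2 ≤ m ∧ k ≠ 0 ∧ ∀ d : ℂ,
      (0 < (d ^ m * k).re → ∀ᶠ t : ℝ in 𝓝[>] 0, 0 < h (x + t * d)) ∧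
      ((d ^ m * k).re < 0 → ∀ᶠ t : ℝ in 𝓝[>] 0, h (x + t * d) < 0) := by
  obtain ⟨r, hr, hball⟩ := Metric.eventually_nhds_iff_ball.1 hh.eventually
  obtain ⟨g, hg, hgh⟩ :=
    InnerProductSpace.HarmonicOnNhd.exists_analyticOnNhd_ball_re_eq (f := h) (z := x) (R := r) hball
  have hxr : x ∈ Metric.ball x r := Metric.mem_ball_self hr
  have hnear : Metric.ball x r ∈ 𝓝 x := Metric.ball_mem_nhds x hr
  have hgx := hg x hxr
  have hre : ∀ z ∈ Metric.ball x r, (g z - g x).re = h z := fun z hz => by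
    have h1 : (g z).re = h z := hgh hz
    have h2 : (g x).re = h x := hgh hxr
    rw [Complex.sub_re, h1, h2, hx, sub_zero]
  have han : AnalyticAt ℂ (fun z => g z - g x) x := hgx.sub analyticAt_const
  have hnz : ¬ ∀ᶠ z in 𝓝 x, g z - g x = 0 := fun hz => hne <| by
    filter_upwards [hz, hnear] with z hz hzb
    rw [← hre z hzb, hz, Complex.zero_re]
  obtain ⟨m, k, hk, hk0, hkeq⟩ := han.exists_eventuallyEq_pow_smul_nonzero_iff.2 hnz
  simp only [smul_eq_mul] at hkeq
  have hm0 : m ≠ 0 := by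
    rintro rfl
    have := hkeq.self_of_nhds
    simp at this
    exact hk0 this.symm
  have hm1 : m ≠ 1 := by
    rintro rfl
    have hder : HasDerivAt (fun z => (z - x) ^ 1 * k z) (k x) x := by
      have h1 : HasDerivAt (fun z : ℂ => z - x) 1 x := (hasDerivAt_id x).sub_const x
      have h2 := h1.fun_mul hk.differentiableAt.hasDerivAt
      simpa using h2
    have hgd := hder.congr_of_eventuallyEq hkeq
    have hfd := (Complex.reCLM.hasFDerivAt (x := g x - g x)).comp x
      (hgd.hasFDerivAt.restrictScalars ℝ)
    have hfd' : HasFDerivAt h _ x := hfd.congr_of_eventuallyEq (by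
      filter_upwards [hnear] with z hz
      exact (hre z hz).symm)
    have h0 := hfd'.fderiv
    rw [hd] at h0
    have := congrArg (fun A : ℂ →L[ℝ] ℝ => A ((starRingEnd ℂ) (k x))) h0
    simp [← Complex.normSq_apply] at this
    exact hk0 (Complex.normSq_eq_zero.1 this.symm)
  have expand : ∀ d : ℂ, ∃ ψ : ℝ → ℝ, Tendsto ψ (𝓝[>] 0) (𝓝 (d ^ m * k x).re) ∧
      ∀ᶠ t : ℝ in 𝓝[>] 0, h (x + t * d) = t ^ m * ψ t := by
    intro d
    have hline : Tendsto (fun t : ℝ => x + t * d) (𝓝[>] 0) (𝓝 x) := by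
      have : Continuous (fun t : ℝ => x + t * d) := by fun_prop
      exact (this.tendsto' 0 x (by simp)).mono_left nhdsWithin_le_nhds
    refine ⟨fun t => (d ^ m * k (x + t * d)).re, ?_, ?_⟩
    · exact (Complex.continuous_re.tendsto _).comp
        (((hk.continuousAt.tendsto).comp hline).const_mul (d ^ m))
    · filter_upwards [hline.eventually hkeq, hline.eventually hnear] with t ht htb
      rw [← hre _ htb, ht, add_sub_cancel_left, mul_pow, mul_assoc, ← Complex.ofReal_pow,
        Complex.re_ofReal_mul]
  refine ⟨m, k x, by omega, hk0, fun d => ?_⟩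
  obtain ⟨ψ, hψ, hψe⟩ := expand d
  constructor
  · intro hpos
    filter_upwards [hψe, hψ.eventually (lt_mem_nhds hpos), self_mem_nhdsWithin] with t h1 h2 h3
    rw [h1]; exact mul_pos (pow_pos h3 m) h2
  · intro hneg
    filter_upwards [hψe, hψ.eventually (gt_mem_nhds hneg), self_mem_nhdsWithin] with t h1 h2 h3
    rw [h1]; exact mul_neg_of_pos_of_neg (pow_pos h3 m) h2

/-- A harmonic function on the interior of a compact plane set whose boundary values change sign
only twice has no degenerate zero in the interior. -/
theorem fderiv_ne_zero_of_isPreconnected_frontier {V : Set ℂ} (hV : IsCompact V) {h : ℂ → ℝ}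
    (hc : ContinuousOn h V) (hh : InnerProductSpace.HarmonicOnNhd h (interior V))
    (hp : IsPreconnected {z | z ∈ frontier V ∧ 0 < h z})
    (hn : IsPreconnected {z | z ∈ frontier V ∧ h z < 0})
    {x : ℂ} (hx : x ∈ interior V) (hx0 : h x = 0) (hne : ¬ ∀ᶠ z in 𝓝 x, h z = 0) :
    fderiv ℝ h x ≠ 0 := by
  intro hd
  have hP := isPreconnected_pos_of_harmonic hV hc hh hp
  have hN : IsPreconnected {z | z ∈ V ∧ h z < 0} := by
    have := isPreconnected_pos_of_harmonic (h := -h) hV hc.neg (fun z hz => (hh z hz).neg)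
      (by simpa using hn)
    simpa using this
  obtain ⟨m, k, hm, hk0, hdir⟩ := HarmonicAt.exists_order_of_critical (hh x hx) hx0 hd hne
  have hm0 : (m : ℝ) ≠ 0 := by positivity
  have hmc : (m : ℂ) ≠ 0 := by exact_mod_cast hm0
  set dir : ℝ → ℂ := fun θ => Complex.exp (((θ - Complex.arg k / m : ℝ) : ℂ) * Complex.I)
    with hdirdef
  have hdirpow : ∀ θ : ℝ, (dir θ ^ m * k).re = ‖k‖ * Real.cos (m * θ) := by
    intro θ
    have : dir θ ^ m * k = ‖k‖ * Complex.exp ((m * θ : ℝ) * Complex.I) := by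
      conv_lhs => rw [← Complex.norm_mul_exp_arg_mul_I k]
      simp only [hdirdef]
      rw [← Complex.exp_nat_mul, mul_left_comm, ← Complex.exp_add]
      congr 2
      push_cast
      field_simp
      ring
    rw [this, Complex.re_ofReal_mul, Complex.exp_ofReal_mul_I_re]
  have hratio : ∀ a b c : ℝ, -Real.pi < c → c < Real.pi →
      (c = a - b + Real.pi ∨ c = a - b - Real.pi) →
      -dir a / dir b ∈ Complex.slitPlane ∧ Complex.arg (-dir a / dir b) = c := by
    intro a b c h1 h2 h3
    have hval : -dir a / dir b = Complex.exp (c * Complex.I) := by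
      simp only [hdirdef]
      rw [neg_div, ← Complex.exp_sub, neg_eq_neg_one_mul]
      rcases h3 with rfl | rfl
      · rw [← Complex.exp_pi_mul_I, ← Complex.exp_add]
        congr 1; push_cast; ring
      · have : (-1 : ℂ) = Complex.exp (-(Real.pi * Complex.I)) := by
          rw [Complex.exp_neg, Complex.exp_pi_mul_I]; norm_num
        rw [this, ← Complex.exp_add]
        congr 1; push_cast; ring
    have harg : Complex.arg (-dir a / dir b) = c := by
      rw [hval, Complex.arg_exp_mul_I, toIocMod_eq_self]
      constructor <;> [exact h1; linarith]
    refine ⟨Complex.mem_slitPlane_iff_arg.2 ⟨by rw [harg]; exact h2.ne, ?_⟩, harg⟩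
    rw [hval]; exact Complex.exp_ne_zero _
  have hkpos : 0 < ‖k‖ := norm_pos_iff.2 hk0
  set θ : ℝ := Real.pi / m with hθ
  have hmθ : m * θ = Real.pi := by rw [hθ]; field_simp
  have hθpos : 0 < θ := div_pos Real.pi_pos (by positivity)
  have hθle : θ ≤ Real.pi / 2 := by
    rw [hθ]; exact div_le_div_of_nonneg_left Real.pi_pos.le two_pos (by exact_mod_cast hm)
  have hpi := Real.pi_pos
  obtain ⟨s1, a1⟩ := hratio θ 0 (θ - Real.pi) (by linarith) (by linarith) (by right; ring)
  obtain ⟨s2, a2⟩ := hratio 0 (-θ) (θ - Real.pi) (by linarith) (by linarith) (by right; ring)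
  obtain ⟨s3, a3⟩ := hratio θ (2 * θ) (Real.pi - θ) (by linarith) (by linarith) (by left; ring)
  obtain ⟨s4, a4⟩ := hratio (2 * θ) (-θ) (3 * θ - Real.pi) (by linarith) (by linarith)
    (by right; ring)
  have hinside : ∀ d : ℂ, ∀ᶠ t : ℝ in 𝓝[>] 0, x + t * d ∈ V := fun d => by
    have : Continuous (fun t : ℝ => x + t * d) := by fun_prop
    have := (this.tendsto' 0 x (by simp)).mono_left (nhdsWithin_le_nhds (s := Ioi 0))
    exact (this.eventually (isOpen_interior.mem_nhds hx)).mono fun t ht => interior_subset ht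
  have hpos : ∀ τ : ℝ, Real.cos (m * τ) = 1 → ∀ᶠ t : ℝ in 𝓝[>] 0,
      x + t * dir τ ∈ {z | z ∈ V ∧ 0 < h z} := fun τ hτ =>
    (hinside _).and ((hdir (dir τ)).1 (by rw [hdirpow, hτ]; simpa using hkpos))
  have hneg : ∀ τ : ℝ, Real.cos (m * τ) = -1 → ∀ᶠ t : ℝ in 𝓝[>] 0,
      x + t * dir τ ∈ {z | z ∈ V ∧ h z < 0} := fun τ hτ =>
    (hinside _).and ((hdir (dir τ)).2 (by rw [hdirpow, hτ]; simpa using hkpos))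
  have e1 := hpos 0 (by simp)
  have e2 := hpos (2 * θ) (by rw [mul_left_comm, hmθ, Real.cos_two_pi])
  have e3 := (hneg θ (by rw [hmθ, Real.cos_pi])).and
    (hneg (-θ) (by rw [mul_neg, hmθ, Real.cos_neg, Real.cos_pi]))
  obtain ⟨ρ, hρ, hsub⟩ := mem_nhdsGT_iff_exists_Ioc_subset.1 e3
  have hρ : 0 < ρ := hρ
  have hρmem := hsub (show ρ ∈ Ioc 0 ρ from ⟨hρ, le_rfl⟩)
  have hK : IsCompact {z | z ∈ V ∧ 0 ≤ h z} :=
    hV.of_isClosed_subset (hc.preimage_isClosed_of_isClosed hV.isClosed isClosed_Ici)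
      fun z hz => hz.1
  obtain ⟨L, hL, hLe⟩ := exists_log_div_of_isPreconnected hK hN
    (disjoint_left.2 fun z hz hz' => hz.2.not_gt hz'.2) hρmem.1 hρmem.2
  have := arg_add_arg_eq_of_log (K := {z | z ∈ V ∧ 0 ≤ h z}) hP (fun z hz => ⟨hz.1, hz.2.le⟩) hρ
    (show x ∈ {z | z ∈ V ∧ 0 ≤ h z} from ⟨interior_subset hx, hx0.ge⟩)
    (fun hx' => hx'.2.ne' hx0)
    (fun t h1 h2 h3 => (hsub (show t ∈ Ioc 0 ρ from ⟨h1, h2⟩)).1.2.not_gt h3.2)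
    (fun t h1 h2 h3 => (hsub (show t ∈ Ioc 0 ρ from ⟨h1, h2⟩)).2.2.not_gt h3.2)
    hL hLe e1 e2 s1 s2 s3 s4
  rw [a1, a2, a3, a4] at this
  linarith

theorem Convex.isSimplyConnected_of_nonempty {E : Type*} [AddCommGroup E] [Module ℝ E]
    [TopologicalSpace E] [ContinuousAdd E] [ContinuousSMul ℝ E] {s : Set E} (hs : Convex ℝ s)
    (hne : s.Nonempty) : IsSimplyConnected s :=
  have := hs.contractibleSpace hne
  (inferInstance : SimplyConnectedSpace s)

/-- On a bounded plane set, the boundary values `z - x` with `x` inside have no nonvanishing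
continuous extension. -/
theorem not_exists_nonvanishing_extension {O : Set ℂ} (hb : Bornology.IsBounded O)
    {x : ℂ} (hx : x ∈ O) {k : ℂ → ℂ} (hk : ContinuousOn k (closure O))
    (hk0 : ∀ z ∈ closure O, k z ≠ 0) (hkf : ∀ z ∈ frontier O, k z = z - x) : False := by
  classical
  set G : ℂ → ℂ := (closure O).piecewise k (fun z => z - x) with hG
  have hGc : Continuous G := by
    refine continuous_piecewise (fun z hz => hkf z (frontier_closure_subset hz)) ?_ (by fun_prop)
    rwa [closure_closure]
  have hG0 : ∀ z, G z ≠ 0 := by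
    intro z
    by_cases hz : z ∈ closure O
    · rw [hG, piecewise_eq_of_mem _ _ _ hz]; exact hk0 z hz
    · rw [hG, piecewise_eq_of_notMem _ _ _ hz]
      intro h0
      exact hz (subset_closure (by rwa [sub_eq_zero.1 h0]))
  have hsc : IsSimplyConnected (univ : Set ℂ) :=
    convex_univ.isSimplyConnected_of_nonempty univ_nonempty
  obtain ⟨f, hf, hfe⟩ := Complex.exists_continuousOn_eqOn_exp_comp hsc isOpen_univ
    hGc.continuousOn (by rintro ⟨z, -, hz⟩; exact hG0 z hz)
  have hf := continuousOn_univ.1 hf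
  obtain ⟨R, hR, hRsub⟩ := hb.closure.subset_ball_lt 0 x
  have hcirc : ∀ t : ℝ, Complex.exp (f (x + R * Complex.exp (t * Complex.I))) =
      R * Complex.exp (t * Complex.I) := by
    intro t
    have h1 := hfe (mem_univ (x + R * Complex.exp (t * Complex.I)))
    simp only [Function.comp_apply] at h1
    rw [h1, hG, piecewise_eq_of_notMem _ _ _ ?_, add_sub_cancel_left]
    intro hmem
    have := hRsub hmem
    rw [Metric.mem_ball, dist_eq_norm, add_sub_cancel_left, norm_mul, Complex.norm_exp_ofReal_mul_I,
      Complex.norm_real, Real.norm_of_nonneg hR.le, mul_one] at this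
    exact lt_irrefl _ this
  have hR0 : (R : ℂ) ≠ 0 := by exact_mod_cast hR.ne'
  set m : ℝ → ℂ := fun t => f (x + R * Complex.exp (t * Complex.I)) with hm
  have heq : EqOn m (fun t : ℝ => m 0 + t * Complex.I) univ := by
    refine Complex.isCoveringMap_exp.eqOn_of_comp_eqOn isPreconnected_univ
      (by simp only [hm]; fun_prop) (by fun_prop) ?_ (mem_univ 0) (by simp)
    intro t _
    apply Subtype.ext
    simp only [Function.comp_apply]
    have h0 := hcirc 0
    simp only [Complex.ofReal_zero, zero_mul, Complex.exp_zero, mul_one] at h0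
    rw [Complex.exp_add, hm, hcirc t]
    simp only [Complex.ofReal_zero, zero_mul, Complex.exp_zero, mul_one]
    rw [h0]
  have h2 := heq (mem_univ (2 * Real.pi))
  have h3 : m (2 * Real.pi) = m 0 := by
    simp only [hm]
    push_cast
    rw [Complex.exp_two_pi_mul_I]
    simp
  rw [h3] at h2
  simp [Real.pi_ne_zero] at h2

/-- A continuous `1`-periodic function of the parameter of a Jordan curve is a continuous function
of the point on the curve. -/
theorem exists_continuous_descent {Γ : ℝ → ℂ} (hΓ : Continuous Γ) (hper : ∀ t, Γ (t + 1) = Γ t)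
    (hinj : InjOn Γ (Ico (0 : ℝ) 1)) {N : ℝ → ℂ} (hN : Continuous N)
    (hNper : ∀ t, N (t + 1) = N t) :
    ∃ L : ℂ → ℂ, Continuous L ∧ ∀ t ∈ Ico (0 : ℝ) 1, L (Γ t) = N t := by
  have hcpt : IsCompact (Γ '' Icc (0 : ℝ) 1) := isCompact_Icc.image hΓ
  have : ∀ z : Γ '' Icc (0 : ℝ) 1, ∃ t ∈ Ico (0 : ℝ) 1, Γ t = z := by
    rintro ⟨_, t, ht, rfl⟩
    rcases ht.2.lt_or_eq with h | rfl
    · exact ⟨t, ⟨ht.1, h⟩, rfl⟩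
    · exact ⟨0, by simp, by simpa using (hper 0).symm⟩
  choose σ hσ hσΓ using this
  let q : Icc (0 : ℝ) 1 → Γ '' Icc (0 : ℝ) 1 := fun t => ⟨Γ t, mem_image_of_mem Γ t.2⟩
  have hq : Continuous q := Continuous.subtype_mk (hΓ.comp continuous_subtype_val) _
  have hqs : Function.Surjective q := by
    rintro ⟨_, t, ht, rfl⟩
    exact ⟨⟨t, ht⟩, rfl⟩
  have hquot : IsQuotientMap q := hq.isClosedMap.isQuotientMap hq hqs
  have hval : ∀ t : Icc (0 : ℝ) 1, N (σ (q t)) = N t := by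
    rintro ⟨t, ht⟩
    have h1 := hσΓ (q ⟨t, ht⟩)
    have h2 := hσ (q ⟨t, ht⟩)
    rcases ht.2.lt_or_eq with h | rfl
    · exact congrArg N (hinj h2 ⟨ht.1, h⟩ h1)
    · have h3 : Γ (σ (q ⟨1, ht⟩)) = Γ 0 := h1.trans (show Γ 1 = Γ 0 by simpa using hper 0)
      rw [hinj h2 (by simp) h3]
      simpa using (hNper 0).symm
  have hcont : Continuous fun z => N (σ z) := by
    rw [hquot.continuous_iff]
    exact (hN.comp continuous_subtype_val).congr fun t => (hval t).symm
  obtain ⟨L, hL⟩ := ContinuousMap.exists_restrict_eq hcpt.isClosed ⟨_, hcont⟩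
  refine ⟨L, L.continuous, fun t ht => ?_⟩
  have ht' : t ∈ Icc (0 : ℝ) 1 := Ico_subset_Icc_self ht
  have := DFunLike.congr_fun hL (q ⟨t, ht'⟩)
  exact this.trans (hval ⟨t, ht'⟩)

/-- If a Jordan curve bounding a compact set winds once around every interior point, then the
interior is connected. -/
theorem isPreconnected_interior_of_winding {V : Set ℂ} (hV : IsCompact V) {Γ : ℝ → ℂ}
    (hΓ : Continuous Γ) (hper : ∀ t, Γ (t + 1) = Γ t) (hinj : InjOn Γ (Ico (0 : ℝ) 1))
    (himg : Γ '' Ico (0 : ℝ) 1 = frontier V)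
    (hwind : ∀ z ∈ interior V, ∃ M : ℝ → ℂ, Continuous M ∧ (∀ t, Complex.exp (M t) = Γ t - z) ∧
      ∀ t, M (t + 1) = M t + 2 * Real.pi * Complex.I) :
    IsPreconnected (interior V) := by
  intro A B hA hB hcov hAne hBne
  by_contra hdis
  obtain ⟨x, hx, hxA⟩ := hAne
  obtain ⟨y, hy, hyB⟩ := hBne
  have hO : IsOpen (interior V ∩ A) := isOpen_interior.inter hA
  have hOV : closure (interior V ∩ A) ⊆ V :=
    closure_minimal (inter_subset_left.trans interior_subset) hV.isClosed
  have hsep : ∀ z ∈ interior V, z ∈ B → z ∉ closure (interior V ∩ A) := by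
    intro z hz hzB hzc
    obtain ⟨w, hwB, hwV, hwA⟩ := mem_closure_iff.1 hzc B hB hzB
    exact hdis ⟨w, hwV, hwA, hwB⟩
  have hfr : frontier (interior V ∩ A) ⊆ frontier V := by
    intro z hz
    rw [hO.frontier_eq] at hz
    refine ⟨subset_closure (hOV hz.1), fun hzV => ?_⟩
    rcases hcov hzV with h | h
    · exact hz.2 ⟨hzV, h⟩
    · exact hsep z hzV h hz.1
  obtain ⟨M₁, hM₁, hM₁e, hM₁p⟩ := hwind x hx
  obtain ⟨M₂, hM₂, hM₂e, hM₂p⟩ := hwind y hy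
  obtain ⟨L, hL, hLN⟩ := exists_continuous_descent hΓ hper hinj (hM₁.sub hM₂)
    (fun t => by
      show M₁ (t + 1) - M₂ (t + 1) = M₁ t - M₂ t
      rw [hM₁p, hM₂p]
      ring)
  refine not_exists_nonvanishing_extension (hV.isBounded.subset (subset_closure.trans hOV))
    ⟨hx, hxA⟩ (k := fun z => (z - y) * Complex.exp (L z)) (by fun_prop) ?_ ?_
  · intro z hz
    refine mul_ne_zero (fun h0 => ?_) (Complex.exp_ne_zero _)
    exact hsep y hy hyB (by rwa [← sub_eq_zero.1 h0])
  · intro z hz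
    obtain ⟨t, ht, rfl⟩ := himg.symm ▸ hfr hz
    rw [hLN t ht, Pi.sub_apply, Complex.exp_sub, hM₁e, hM₂e, mul_div_cancel₀]
    rw [← hM₂e]; exact Complex.exp_ne_zero _

theorem HarmonicOn2.harmonicOnNhd {u : ℝ × ℝ → ℝ} {Ω : Set (ℝ × ℝ)} (hΩ : IsOpen Ω)
    (hu : HarmonicOn2 u Ω) :
    InnerProductSpace.HarmonicOnNhd (u ∘ Complex.equivRealProdCLM)
      (Complex.equivRealProdCLM ⁻¹' Ω) := by
  intro z hz
  have hΩ' : IsOpen (Complex.equivRealProdCLM ⁻¹' Ω) :=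
    hΩ.preimage Complex.equivRealProdCLM.continuous
  have hcd : ∀ p ∈ Ω, ContDiffAt ℝ 2 u p := fun p hp => hu.1.contDiffAt (hΩ.mem_nhds hp)
  refine ⟨(hcd _ hz).comp z Complex.equivRealProdCLM.contDiff.contDiffAt, ?_⟩
  filter_upwards [hΩ'.mem_nhds hz] with ζ hζ
  have hd : DifferentiableAt ℝ (fderiv ℝ u) (Complex.equivRealProdCLM ζ) :=
    ((hcd _ hζ).fderiv_right (m := 1) (by norm_num)).differentiableAt (by norm_num)
  have h := hu.2 _ hζ
  rw [lap2, fderiv_clm_apply hd (by fun_prop), fderiv_clm_apply hd (by fun_prop)] at h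
  rw [InnerProductSpace.laplacian_eq_iteratedFDeriv_complexPlane]
  dsimp only
  rw [← iteratedFDerivWithin_univ, ← preimage_univ (f := Complex.equivRealProdCLM),
    ContinuousLinearEquiv.iteratedFDerivWithin_comp_right _ _ uniqueDiffOn_univ (mem_univ _),
    iteratedFDerivWithin_univ]
  simp [iteratedFDeriv_two_apply] at h ⊢
  exact h

theorem harmonicOnNhd_finset_sum {ι : Type*} {s : Finset ι} {f : ι → ℂ → ℝ} {S : Set ℂ}
    (hf : ∀ i ∈ s, InnerProductSpace.HarmonicOnNhd (f i) S) :
    InnerProductSpace.HarmonicOnNhd (fun z => ∑ i ∈ s, f i z) S := by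
  classical
  induction s using Finset.induction_on with
  | empty =>
    simp
  | insert a t ha ih =>
    intro z hz
    have h := (hf a (Finset.mem_insert_self a t) z hz).add
      (ih (fun i hi => hf i (Finset.mem_insert_of_mem hi)) z hz)
    convert h using 1
    funext x
    simp [Finset.sum_insert ha]

theorem apply_eq_fst_mul_add_snd_mul (ℓ : ℝ × ℝ →L[ℝ] ℝ) (p : ℝ × ℝ) :
    ℓ p = p.1 * ℓ (1, 0) + p.2 * ℓ (0, 1) := by
  have : p = p.1 • ((1, 0) : ℝ × ℝ) + p.2 • ((0, 1) : ℝ × ℝ) := by ext <;> simp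
  conv_lhs => rw [this]
  simp only [map_add, map_smul, smul_eq_mul]

/-- A simple closed curve in the plane is not contained in a line. -/
theorem not_loop_subset_line {δ : ℝ → ℝ × ℝ} (hδ : Continuous δ) (hper : δ 1 = δ 0)
    (hinj : InjOn δ (Ico (0 : ℝ) 1)) {ℓ : ℝ × ℝ →L[ℝ] ℝ} (hℓ : ℓ ≠ 0) {c : ℝ}
    (hc : ∀ t ∈ Ico (0 : ℝ) 1, ℓ (δ t) = c) : False := by
  set a := ℓ (1, 0) with ha
  set b := ℓ (0, 1) with hb
  have hab : 0 < a ^ 2 + b ^ 2 := by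
    by_contra h
    refine hℓ (ContinuousLinearMap.ext fun p => ?_)
    have h1 : a = 0 := by nlinarith [sq_nonneg a, sq_nonneg b]
    have h2 : b = 0 := by nlinarith [sq_nonneg a, sq_nonneg b]
    rw [apply_eq_fst_mul_add_snd_mul ℓ p, ← ha, ← hb, h1, h2]
    simp
  let m : ℝ → ℝ := fun t => a * (δ t).2 - b * (δ t).1
  have hm : Continuous m := by fun_prop
  have hm1 : m 1 = m 0 := by simp only [m, hper]
  have hminj : InjOn m (Ico (0 : ℝ) 1) := by
    intro s hs t ht hst
    have h1 := (hc s hs).trans (hc t ht).symm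
    rw [apply_eq_fst_mul_add_snd_mul ℓ (δ s), apply_eq_fst_mul_add_snd_mul ℓ (δ t), ← ha,
      ← hb] at h1
    simp only [m] at hst
    refine hinj hs ht (Prod.ext ?_ ?_)
    · have : (a ^ 2 + b ^ 2) * ((δ s).1 - (δ t).1) = 0 := by linear_combination a * h1 - b * hst
      rcases mul_eq_zero.1 this with h | h <;> linarith
    · have : (a ^ 2 + b ^ 2) * ((δ s).2 - (δ t).2) = 0 := by linear_combination b * h1 + a * hst
      rcases mul_eq_zero.1 this with h | h <;> linarith
  have hne : m 0 ≠ m (1 / 2) := fun h => by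
    have := hminj (by norm_num) (by norm_num) h
    norm_num at this
  have key : ∃ c, c ∈ m '' Ioo 0 (1 / 2) ∧ c ∈ m '' Ioo (1 / 2) 1 := by
    rcases hne.lt_or_gt with h | h
    · obtain ⟨c, hc⟩ := exists_between h
      exact ⟨c, intermediate_value_Ioo (by norm_num) hm.continuousOn hc,
        intermediate_value_Ioo' (by norm_num) hm.continuousOn (by rwa [hm1])⟩
    · obtain ⟨c, hc⟩ := exists_between h
      exact ⟨c, intermediate_value_Ioo' (by norm_num) hm.continuousOn hc,
        intermediate_value_Ioo (by norm_num) hm.continuousOn (by rwa [hm1])⟩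
  obtain ⟨c, ⟨s, hs, hsc⟩, t, ht, htc⟩ := key
  have := hminj ⟨hs.1.le, hs.2.trans (by norm_num)⟩ ⟨le_trans (by norm_num) ht.1.le, ht.2⟩
    (hsc.trans htc.symm)
  linarith [hs.2, ht.1]

theorem exists_linear_eq_const_of_interior_eq_empty {W : Set (ℝ × ℝ)} (hW : Convex ℝ W)
    (hne : W.Nonempty) (hinside : ¬ (interior W).Nonempty) :
    ∃ ℓ : ℝ × ℝ →L[ℝ] ℝ, ℓ ≠ 0 ∧ ∃ c, ∀ z ∈ W, ℓ z = c := by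
  rw [hW.interior_nonempty_iff_affineSpan_eq_top,
    ← AffineSubspace.direction_eq_top_iff_of_nonempty ((affineSpan_nonempty ℝ).2 hne)] at hinside
  obtain ⟨f, hf, hle⟩ := Submodule.exists_le_ker_of_lt_top _ (lt_top_iff_ne_top.2 hinside)
  obtain ⟨z₀, hz₀⟩ := hne
  refine ⟨f.toContinuousLinearMap, by simpa using hf, f z₀, fun z hz => ?_⟩
  have : z -ᵥ z₀ ∈ (affineSpan ℝ W).direction :=
    AffineSubspace.vsub_mem_direction (subset_affineSpan ℝ W hz) (subset_affineSpan ℝ W hz₀)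
  have h := hle this
  rw [LinearMap.mem_ker, vsub_eq_sub, map_sub, sub_eq_zero] at h
  simpa using h

/-- The part of the boundary of a compact convex set lying strictly on one side of a line through
an interior point is connected. -/
theorem isPreconnected_frontier_inter_halfSpace {X : Type*} [NormedAddCommGroup X]
    [NormedSpace ℝ X] {W : Set X} (hW : Convex ℝ W) (hWc : IsCompact W) {y : X}
    (hy : y ∈ interior W) (ℓ : X →L[ℝ] ℝ) : IsPreconnected {z | z ∈ frontier W ∧ ℓ y < ℓ z} := by
  set S : Set X := Homeomorph.addLeft y ⁻¹' W with hS
  have hSc : Convex ℝ S := hW.translate_preimage_right y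
  have hS0 : S ∈ 𝓝 (0 : X) := by
    refine (Homeomorph.addLeft y).continuous.continuousAt.preimage_mem_nhds ?_
    simpa using mem_interior_iff_mem_nhds.1 hy
  have hSb : Bornology.IsVonNBounded ℝ S := by
    have : IsCompact S := (Homeomorph.addLeft y).isCompact_preimage.2 hWc
    exact NormedSpace.isVonNBounded_of_isBounded ℝ this.isBounded
  have hfr : ∀ d, d ∈ frontier S ↔ y + d ∈ frontier W := by
    intro d
    rw [hS, ← Homeomorph.preimage_frontier]
    rfl
  have hgpos : ∀ d, 0 < ℓ d → 0 < gauge S d := by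
    intro d hd
    rw [gauge_pos (absorbent_nhds_zero hS0) hSb]
    rintro rfl
    simp at hd
  have himg : {z | z ∈ frontier W ∧ ℓ y < ℓ z} =
      (fun d => y + (gauge S d)⁻¹ • d) '' {d | 0 < ℓ d} := by
    ext z
    constructor
    · rintro ⟨hz, hlt⟩
      refine ⟨z - y, by simpa using hlt, ?_⟩
      have : gauge S (z - y) = 1 := by
        rw [gauge_eq_one_iff_mem_frontier hSc hS0, hfr]
        simpa using hz
      simp [this]
    · rintro ⟨d, hd, rfl⟩
      have h0 := hgpos d hd
      refine ⟨?_, ?_⟩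
      · rw [← hfr, ← gauge_eq_one_iff_mem_frontier hSc hS0,
          gauge_smul_of_nonneg (inv_nonneg.2 h0.le), smul_eq_mul, inv_mul_cancel₀ h0.ne']
      · simp only [map_add, map_smul, smul_eq_mul]
        have := mul_pos (inv_pos.2 h0) hd
        linarith
  rw [himg]
  refine IsPreconnected.image ?_ _ ?_
  · exact (convex_halfSpace_gt ℓ.isLinear 0).isPreconnected
  · refine continuousOn_const.add (ContinuousOn.smul ?_ continuousOn_id)
    exact (continuous_gauge hSc hS0).continuousOn.inv₀ fun d hd => (hgpos d hd).ne'

theorem IsPreconnected.inter_preimage_of_injOn {X Y : Type*} [TopologicalSpace X]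
    [TopologicalSpace Y] [T2Space Y] {K : Set X} (hK : IsCompact K) {f : X → Y}
    (hf : ContinuousOn f K) (hinj : InjOn f K) {T : Set Y} (hT : IsPreconnected T)
    (hTK : T ⊆ f '' K) : IsPreconnected (K ∩ f ⁻¹' T) := by
  have := isCompact_iff_compactSpace.1 hK
  have h := hT.preimage_of_isClosedMap (f := K.domRestrict f) (injOn_iff_injective.1 hinj)
    hf.domRestrict.isClosedMap (by rwa [range_domRestrict])
  convert h.image _ continuous_subtype_val.continuousOn using 1
  ext x
  simp [and_comm]

theorem harmonic_eqOn_closure_of_eventuallyEq {U : Set ℂ} (hU : IsPreconnected U) {h : ℂ → ℝ}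
    (hc : ContinuousOn h (closure U)) (hh : InnerProductSpace.HarmonicOnNhd h U) {x : ℂ}
    (hx : x ∈ U) {c : ℝ} (he : ∀ᶠ z in 𝓝 x, h z = c) : ∀ z ∈ closure U, h z = c := by
  have han : AnalyticOnNhd ℝ h U := fun z hz => HarmonicAt.analyticAt (hh z hz)
  have h1 : EqOn h (fun _ => c) U :=
    han.eqOn_of_preconnected_of_eventuallyEq analyticOnNhd_const hU hx he
  exact h1.of_subset_closure hc continuousOn_const subset_closure Subset.rfl

theorem ContinuousLinearEquiv.preimage_interior_eq {X Y : Type*} [NormedAddCommGroup X]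
    [NormedSpace ℝ X] [NormedAddCommGroup Y] [NormedSpace ℝ Y] (e : X ≃L[ℝ] Y) (s : Set Y) :
    interior (e ⁻¹' s) = e ⁻¹' interior s :=
  (e.toHomeomorph.preimage_interior s).symm

theorem ContinuousLinearEquiv.preimage_frontier_eq {X Y : Type*} [NormedAddCommGroup X]
    [NormedSpace ℝ X] [NormedAddCommGroup Y] [NormedSpace ℝ Y] (e : X ≃L[ℝ] Y) (s : Set Y) :
    frontier (e ⁻¹' s) = e ⁻¹' frontier s :=
  (e.toHomeomorph.preimage_frontier s).symm

theorem ContinuousLinearEquiv.preimage_closure_eq {X Y : Type*} [NormedAddCommGroup X]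
    [NormedSpace ℝ X] [NormedAddCommGroup Y] [NormedSpace ℝ Y] (e : X ≃L[ℝ] Y) (s : Set Y) :
    closure (e ⁻¹' s) = e ⁻¹' closure s :=
  (e.toHomeomorph.preimage_closure s).symm

/-- No nonzero linear functional composed with a harmonic map has a critical point, when the map
sends the boundary homeomorphically onto the boundary of a convex set. -/
theorem fderiv_comp_ne_zero_of_bijOn_frontier {V W : Set (ℝ × ℝ)} (hV : IsCompact V)
    (hU : IsPreconnected (interior V)) (hVcl : V = closure (interior V)) (hWconv : Convex ℝ W)
    (hW : IsCompact W) {F : ℝ × ℝ → ℝ × ℝ} (hF : ContinuousOn F V)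
    (hh : ∀ ℓ : ℝ × ℝ →L[ℝ] ℝ, InnerProductSpace.HarmonicOnNhd
      ((ℓ ∘ F) ∘ Complex.equivRealProdCLM) (Complex.equivRealProdCLM ⁻¹' interior V))
    (hbij : BijOn F (frontier V) (frontier W)) (hmaps : MapsTo F (interior V) (interior W))
    {ℓ : ℝ × ℝ →L[ℝ] ℝ} (hℓ : ∀ c, ¬ ∀ z ∈ V, ℓ (F z) = c)
    {x : ℝ × ℝ} (hx : x ∈ interior V) (hdiff : DifferentiableAt ℝ F x) :
    ℓ ∘SL fderiv ℝ F x ≠ 0 := by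
  intro hcon
  set e := Complex.equivRealProdCLM with he
  have hV' : IsCompact (e ⁻¹' V) := e.toHomeomorph.isCompact_preimage.2 hV
  set c := ℓ (F x) with hcdef
  have hcont : ContinuousOn (fun z => ℓ (F (e z)) - c) (e ⁻¹' V) :=
    (ℓ.continuous.comp_continuousOn
      (hF.comp e.continuous.continuousOn fun z hz => hz)).sub continuousOn_const
  have hharm : InnerProductSpace.HarmonicOnNhd (fun z => ℓ (F (e z)) - c) (e ⁻¹' interior V) :=
    (hh ℓ).sub (InnerProductSpace.harmonicOnNhd_const c)
  have hfrc : IsCompact (frontier V) := hV.of_isClosed_subset isClosed_frontier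
    hV.isClosed.frontier_subset
  have hside : ∀ m : ℝ × ℝ →L[ℝ] ℝ,
      IsPreconnected {z | z ∈ frontier (e ⁻¹' V) ∧ m (F x) < m (F (e z))} := by
    intro m
    have h1 := isPreconnected_frontier_inter_halfSpace hWconv hW (hmaps hx) m
    have h2 := h1.inter_preimage_of_injOn hfrc (hF.mono hV.isClosed.frontier_subset) hbij.injOn
      (fun z hz => hbij.image_eq.symm ▸ hz.1)
    have h3 := h2.image e.symm e.symm.continuous.continuousOn
    convert h3 using 1
    ext z
    rw [e.preimage_frontier_eq]
    constructor
    · rintro ⟨hz, hlt⟩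
      exact ⟨e z, ⟨hz, hbij.mapsTo hz, hlt⟩, by simp⟩
    · rintro ⟨p, ⟨hp, -, hlt⟩, rfl⟩
      exact ⟨by simpa using hp, by simpa using hlt⟩
  refine fderiv_ne_zero_of_isPreconnected_frontier hV' hcont ?_ ?_ ?_ (x := e.symm x) ?_ ?_ ?_ ?_
  · rwa [e.preimage_interior_eq]
  · simpa only [sub_pos] using hside ℓ
  · have := hside (-ℓ)
    simpa only [neg_apply, neg_lt_neg_iff, sub_neg] using this
  · rw [e.preimage_interior_eq]; simpa using hx
  · simp [hcdef]
  · intro hev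
    have hU' : IsPreconnected (e ⁻¹' interior V) := by
      have : e ⁻¹' interior V = e.symm '' interior V :=
        e.symm.toEquiv.image_eq_preimage_symm _ |>.symm
      rw [this]
      exact hU.image _ e.symm.continuous.continuousOn
    have hcl : closure (e ⁻¹' interior V) = e ⁻¹' V := by rw [e.preimage_closure_eq, ← hVcl]
    have := harmonic_eqOn_closure_of_eventuallyEq hU' (hcl ▸ hcont) hharm
      (x := e.symm x) (by simpa using hx) hev
    refine hℓ c fun z hz => ?_
    have h := this (e.symm z) (by rw [hcl]; simpa using hz)
    simpa [sub_eq_zero] using h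
  · have hd : DifferentiableAt ℝ F (e (e.symm x)) := by simpa using hdiff
    have h1 : HasFDerivAt (fun z => ℓ (F (e z)) - c)
        ((ℓ ∘SL fderiv ℝ F (e (e.symm x))) ∘SL (e : ℂ →L[ℝ] ℝ × ℝ)) (e.symm x) :=
      (((ℓ.hasFDerivAt.comp _ hd.hasFDerivAt).comp _ e.hasFDerivAt)).sub_const c
    rw [h1.fderiv, e.apply_symm_apply, hcon, ContinuousLinearMap.zero_comp]

theorem isLocalHomeomorphOn_subtype_val {X : Type*} [TopologicalSpace X] {V U : Set X}
    (hU : IsOpen U) (hUV : U ⊆ V) :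
    IsLocalHomeomorphOn (Subtype.val : V → X) (Subtype.val ⁻¹' U) := by
  rw [isLocalHomeomorphOn_iff_isOpenEmbedding_restrict]
  intro x hx
  refine ⟨Subtype.val ⁻¹' U, (hU.preimage continuous_subtype_val).mem_nhds hx, ?_⟩
  refine ⟨IsEmbedding.subtypeVal.comp IsEmbedding.subtypeVal, ?_⟩
  have : range ((Subtype.val ⁻¹' U : Set V).domRestrict (Subtype.val : V → X)) = U := by
    rw [range_domRestrict, Subtype.image_preimage_coe, inter_eq_right]
    exact hUV
  rwa [this]

/-- A local homeomorphism between the interiors that maps boundary to boundary is a bijection onto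
a simply connected interior. -/
theorem bijOn_of_isLocalHomeomorphOn {X Y : Type*} [TopologicalSpace X] [T2Space X]
    [TopologicalSpace Y] [T2Space Y] [LocallyPathConnectedSpace Y] {V U : Set X} {O : Set Y}
    (hV : IsCompact V) (hUo : IsOpen U) (hUV : U ⊆ V) (hU : IsPreconnected U) (hne : U.Nonempty)
    (hO : IsOpen O) (hOsc : IsSimplyConnected O) {F : X → Y} (hF : ContinuousOn F V)
    (hmaps : MapsTo F U O) (hbd : ∀ x ∈ V, F x ∈ O → x ∈ U) (hloc : IsLocalHomeomorphOn F U) :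
    BijOn F U O := by
  have := isCompact_iff_compactSpace.1 hV
  have := hOsc.simplyConnectedSpace
  have := hO.locallyPathConnectedSpace
  set f : V → Y := V.domRestrict F with hf
  have hpre : f ⁻¹' O = Subtype.val ⁻¹' U := by
    ext x
    exact ⟨fun h => hbd x x.2 h, fun h => hmaps h⟩
  have hcov : IsCoveringMapOn f O := by
    refine IsCoveringMapOn.of_isLocalHomeomorphOn hF.domRestrict ?_
    rw [hpre]
    exact hloc.comp (isLocalHomeomorphOn_subtype_val hUo hUV) fun _ h => h
  have hp := hcov.isCoveringMap_restrictPreimage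
  have hcon : PreconnectedSpace (f ⁻¹' O) := by
    rw [← isPreconnected_iff_preconnectedSpace, ← IsInducing.subtypeVal.isPreconnected_image, hpre,
      Subtype.image_preimage_coe, inter_eq_right.2 hUV]
    exact hU
  obtain ⟨x₀, hx₀⟩ := hne
  let e₀ : f ⁻¹' O := ⟨⟨x₀, hUV hx₀⟩, hmaps hx₀⟩
  obtain ⟨σ, ⟨hσ, hpσ⟩, -⟩ := hp.existsUnique_continuousMap_lifts (ContinuousMap.id O)
    (O.restrictPreimage f e₀) e₀ rfl
  have hσp : σ ∘ O.restrictPreimage f = id := by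
    refine hp.eq_of_comp_eq (σ.continuous.comp hp.continuous) continuous_id ?_ e₀ hσ
    rw [← Function.comp_assoc, hpσ]
    rfl
  refine ⟨hmaps, fun x hx y hy hxy => ?_, fun y hy => ?_⟩
  · have hinj : Function.Injective (O.restrictPreimage f) :=
      Function.LeftInverse.injective (g := σ) (congrFun hσp)
    have := @hinj ⟨⟨x, hUV hx⟩, hmaps hx⟩ ⟨⟨y, hUV hy⟩, hmaps hy⟩ (Subtype.ext hxy)
    exact congrArg (fun z : f ⁻¹' O => ((z : V) : X)) this
  · have h1 := congrFun hpσ ⟨y, hy⟩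
    refine ⟨σ ⟨y, hy⟩, ?_, congrArg Subtype.val h1⟩
    have h2 : (σ ⟨y, hy⟩ : V) ∈ f ⁻¹' O := (σ ⟨y, hy⟩).2
    exact (Set.ext_iff.1 hpre _).1 h2

theorem exists_contDiffOn_inverse {X : Type*} [NormedAddCommGroup X] [NormedSpace ℝ X]
    [CompleteSpace X] [Nonempty X] {n : WithTop ℕ∞} (hn : n ≠ 0) {F : X → X} {U O : Set X}
    (hU : IsOpen U) (hbij : BijOn F U O) (hF : ∀ x ∈ U, ContDiffAt ℝ n F x)
    (hF' : ∀ x ∈ U, ∃ A : X ≃L[ℝ] X, HasFDerivAt F (A : X →L[ℝ] X) x) :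
    ∃ G : X → X, ContDiffOn ℝ n G O ∧ (∀ y ∈ O, F (G y) = y) ∧ ∀ x ∈ U, G (F x) = x := by
  have hinv : InvOn (Function.invFunOn F U) F U O := hbij.invOn_invFunOn
  refine ⟨Function.invFunOn F U, fun y hy => ?_, hinv.2, hinv.1⟩
  obtain ⟨x, hx, rfl⟩ := hbij.surjOn hy
  obtain ⟨A, hA⟩ := hF' x hx
  set e := (hF x hx).toOpenPartialHomeomorph F hA hn with he
  have hxe : x ∈ e.source := (hF x hx).mem_toOpenPartialHomeomorph_source hA hn
  have heF : ∀ z, e z = F z := fun z => rfl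
  have hsym : e.symm (F x) = x := by rw [← heF]; exact e.left_inv hxe
  have hmem : F x ∈ e.target := by rw [← heF]; exact e.map_source hxe
  have hcd : ContDiffAt ℝ n e.symm (F x) := by
    refine e.contDiffAt_symm hmem (f₀' := A) ?_ ?_
    · rw [hsym]; exact hA
    · rw [hsym]; exact hF x hx
  refine (hcd.congr_of_eventuallyEq ?_).contDiffWithinAt
  have hUn : ∀ᶠ y in 𝓝 (F x), e.symm y ∈ U :=
    hcd.continuousAt.eventually (by rw [hsym]; exact hU.mem_nhds hx)
  filter_upwards [hUn, e.open_target.mem_nhds hmem] with y hy hyt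
  have : F (e.symm y) = y := by rw [← heF]; exact e.right_inv hyt
  conv_lhs => rw [← this]
  exact hinv.1 hy

theorem isLocalHomeomorphOn_of_contDiffAt {X : Type*} [NormedAddCommGroup X] [NormedSpace ℝ X]
    [CompleteSpace X] {n : WithTop ℕ∞} (hn : n ≠ 0) {F : X → X} {U : Set X}
    (hF : ∀ x ∈ U, ContDiffAt ℝ n F x)
    (hF' : ∀ x ∈ U, ∃ A : X ≃L[ℝ] X, HasFDerivAt F (A : X →L[ℝ] X) x) :
    IsLocalHomeomorphOn F U := by
  refine IsLocalHomeomorphOn.mk F U fun x hx => ?_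
  obtain ⟨A, hA⟩ := hF' x hx
  exact ⟨(hF x hx).toOpenPartialHomeomorph F hA hn,
    (hF x hx).mem_toOpenPartialHomeomorph_source hA hn, fun _ _ => rfl⟩

theorem IsHarmonicGBC.sum_smul_vertex {n : ℕ} (hn : 0 < n) {v w : ℕ → ℝ × ℝ} {V : Set (ℝ × ℝ)}
    {φ : ℕ → (ℝ × ℝ) → ℝ} (hφ : IsHarmonicGBC n v V φ) (hv : ∀ i, v (i + n) = v i)
    (hw : ∀ i, w (i + n) = w i) (j : ℕ) : ∑ i ∈ Finset.range n, φ i (v j) • w i = w j := by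
  have hvj : v j = v (j % n) := (Function.Periodic.map_mod_nat (f := v) hv j).symm
  have hwj : w j = w (j % n) := (Function.Periodic.map_mod_nat (f := w) hw j).symm
  have hj : j % n < n := Nat.mod_lt _ hn
  rw [hvj, hwj, Finset.sum_eq_single_of_mem (j % n) (Finset.mem_range.2 hj)]
  · rw [hφ.2.2.2.2.2.2 _ _ hj hj, if_pos rfl, one_smul]
  · intro i hi hne
    rw [hφ.2.2.2.2.2.2 _ _ (Finset.mem_range.1 hi) hj, if_neg hne, zero_smul]

/-- The map defined by generalized barycentric coordinates matches the polygonal boundary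
parametrizations. -/
theorem IsHarmonicGBC.sum_smul_boundary {n : ℕ} (hn : 0 < n) {v w : ℕ → ℝ × ℝ}
    {V W : Set (ℝ × ℝ)} {φ : ℕ → (ℝ × ℝ) → ℝ} (hφ : IsHarmonicGBC n v V φ)
    (hv : ∀ i, v (i + n) = v i) (hw : ∀ i, w (i + n) = w i) {γ δ : ℝ → ℝ × ℝ}
    (hγ : IsPolygonalCCWParam γ n v V) (hδ : IsPolygonalCCWParam δ n w W) {t : ℝ} (ht : 0 ≤ t) :
    ∑ i ∈ Finset.range n, φ i (γ t) • w i = δ t := by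
  have hn' : (n : ℝ) ≠ 0 := by exact_mod_cast hn.ne'
  have h0 : 0 ≤ n * t := by positivity
  have hs : n * t - ⌊n * t⌋₊ ∈ Icc (0 : ℝ) 1 :=
    ⟨sub_nonneg.2 (Nat.floor_le h0), by linarith [Nat.lt_floor_add_one (n * t)]⟩
  have ht' : t = (⌊n * t⌋₊ + (n * t - ⌊n * t⌋₊)) / n := by field_simp; ring
  generalize ⌊n * t⌋₊ = j at hs ht'
  generalize n * t - j = s at hs ht'
  rw [ht', hγ.2 j s hs, hδ.2 j s hs, ← hφ.sum_smul_vertex hn hv hw j,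
    ← hφ.sum_smul_vertex hn hv hw (j + 1), Finset.smul_sum, Finset.smul_sum,
    ← Finset.sum_add_distrib]
  refine Finset.sum_congr rfl fun i _ => ?_
  rw [hφ.2.2.2.2.2.1 i j s hs, add_smul, mul_smul, mul_smul]

theorem bijOn_frontier_of_comp_eq {V W : Set (ℝ × ℝ)} {γ δ : ℝ → ℝ × ℝ}
    (hγ : IsCCWBoundaryParam γ V) (hδ : IsCCWBoundaryParam δ W) {F : ℝ × ℝ → ℝ × ℝ}
    (hF : ∀ t ∈ Ico (0 : ℝ) 1, F (γ t) = δ t) : BijOn F (frontier V) (frontier W) := by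
  rw [← hγ.2.2.2.1, ← hδ.2.2.2.1]
  refine ⟨?_, ?_, ?_⟩
  · rintro _ ⟨t, ht, rfl⟩
    exact ⟨t, ht, (hF t ht).symm⟩
  · rintro _ ⟨s, hs, rfl⟩ _ ⟨t, ht, rfl⟩ h
    rw [hF s hs, hF t ht] at h
    rw [hδ.2.2.1 hs ht h]
  · rintro _ ⟨t, ht, rfl⟩
    exact ⟨γ t, ⟨t, ht, rfl⟩, hF t ht⟩

theorem IsCCWBoundaryParam.isPreconnected_interior {V : Set (ℝ × ℝ)} (hV : IsCompact V)
    {γ : ℝ → ℝ × ℝ} (hγ : IsCCWBoundaryParam γ V) : IsPreconnected (interior V) := by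
  obtain ⟨hc, hper, hinj, himg, hwind⟩ := hγ
  set e := Complex.equivRealProdCLM with he
  have h : IsPreconnected (interior (e ⁻¹' V)) := by
    refine isPreconnected_interior_of_winding (e.toHomeomorph.isCompact_preimage.2 hV)
      (Γ := fun t => e.symm (γ t)) (e.symm.continuous.comp hc) (fun t => by rw [hper])
      (e.symm.injective.injOn.comp hinj (mapsTo_univ _ _)) ?_ ?_
    · rw [e.preimage_frontier_eq, ← himg]
      ext z
      constructor
      · rintro ⟨t, ht, rfl⟩
        exact ⟨t, ht, by simp⟩
      · rintro ⟨t, ht, h⟩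
        exact ⟨t, ht, by simp [h]⟩
    · intro z hz
      rw [e.preimage_interior_eq] at hz
      obtain ⟨r, θ, hr, hθ, hpos, heq, hθp⟩ := hwind _ hz
      refine ⟨fun t => (Real.log (r t) : ℂ) + θ t * Complex.I, ?_, ?_, ?_⟩
      · have : Continuous fun t => Real.log (r t) := hr.log fun t => (hpos t).ne'
        fun_prop
      · intro t
        have h1 : e.symm (γ t) - z = e.symm (γ t - e z) := by simp
        rw [h1, heq t, Complex.exp_add, ← Complex.ofReal_exp, Real.exp_log (hpos t),
          Complex.exp_mul_I]
        apply Complex.ext <;>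
          simp [he, Complex.equivRealProdCLM_symm_apply, ← Complex.ofReal_cos, ← Complex.ofReal_sin]
      · intro t
        have hrp : r (t + 1) = r t := by
          have h1 := heq t
          have h2 := heq (t + 1)
          rw [hper, h1, hθp, Real.cos_add_two_pi, Real.sin_add_two_pi, Prod.mk.injEq] at h2
          have := Real.cos_sq_add_sin_sq (θ t)
          linear_combination -Real.cos (θ t) * h2.1 - Real.sin (θ t) * h2.2 -
            (r (t + 1) - r t) * this
        simp only [hrp, hθp]
        push_cast
        ring
  rw [e.preimage_interior_eq] at h
  have := h.image e e.continuous.continuousOn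
  rwa [image_preimage_eq _ e.surjective] at this

theorem HarmonicOn2.contDiffAt {u : ℝ × ℝ → ℝ} {Ω : Set (ℝ × ℝ)} (hΩ : IsOpen Ω)
    (hu : HarmonicOn2 u Ω) {x : ℝ × ℝ} (hx : x ∈ Ω) {n : WithTop ℕ∞} : ContDiffAt ℝ n u x := by
  have h : AnalyticAt ℝ (u ∘ Complex.equivRealProdCLM) (Complex.equivRealProdCLM.symm x) :=
    HarmonicAt.analyticAt (hu.harmonicOnNhd hΩ _ (by simpa using hx))
  have h2 : ContDiffAt ℝ n ((u ∘ Complex.equivRealProdCLM) ∘ Complex.equivRealProdCLM.symm) x :=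
    h.contDiffAt.comp x Complex.equivRealProdCLM.symm.contDiff.contDiffAt
  convert h2 using 1
  ext p
  simp

theorem HarmonicOn2.eq_zero_of_nonneg {u : ℝ × ℝ → ℝ} {U : Set (ℝ × ℝ)} (hUo : IsOpen U)
    (hU : IsPreconnected U) (hu : HarmonicOn2 u U) (hc : ContinuousOn u (closure U))
    (h0 : ∀ z ∈ U, 0 ≤ u z) {x : ℝ × ℝ} (hx : x ∈ U) (hux : u x = 0) :
    ∀ z ∈ closure U, u z = 0 := by
  set e := Complex.equivRealProdCLM with he
  have hh := hu.harmonicOnNhd hUo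
  have hx' : e.symm x ∈ e ⁻¹' U := by simpa using hx
  have hmax : IsLocalMax (-(u ∘ e)) (e.symm x) := by
    filter_upwards [(hUo.preimage e.continuous).mem_nhds hx'] with z hz
    simpa [hux] using h0 _ hz
  have hev := HarmonicAt.eventually_eq_of_isLocalMax (hh _ hx').neg hmax
  have hU' : IsPreconnected (e ⁻¹' U) := by
    have : e ⁻¹' U = e.symm '' U := e.symm.toEquiv.image_eq_preimage_symm _ |>.symm
    rw [this]
    exact hU.image _ e.symm.continuous.continuousOn
  have hc' : ContinuousOn (u ∘ e) (closure (e ⁻¹' U)) := by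
    rw [e.preimage_closure_eq]
    exact hc.comp e.continuous.continuousOn fun z hz => hz
  have := harmonic_eqOn_closure_of_eventuallyEq hU' hc' hh hx' (c := 0)
    (hev.mono fun z hz => by
      have h : -u (e z) = -u (e (e.symm x)) := hz
      rw [e.apply_symm_apply, hux] at h
      simpa using h)
  intro z hz
  have h := this (e.symm z) (by rw [e.preimage_closure_eq]; simpa using hz)
  simpa using h

/-- The harmonic barycentric coordinates map sends interior points to interior points. -/
theorem IsHarmonicGBC.mapsTo_interior {n : ℕ} {v w : ℕ → ℝ × ℝ} {V W : Set (ℝ × ℝ)}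
    {φ : ℕ → (ℝ × ℝ) → ℝ} (hφ : IsHarmonicGBC n v V φ) (hVcl : V = closure (interior V))
    (hU : IsPreconnected (interior V)) (hvV : ∀ i < n, v i ∈ V) (hn : 0 < n)
    (hw : ∀ i, w (i + n) = w i) (hW : W = convexHull ℝ (range w)) (hWi : (interior W).Nonempty) :
    MapsTo (fun x => ∑ i ∈ Finset.range n, φ i x • w i) (interior V) (interior W) := by
  intro x hx
  by_contra hxW
  obtain ⟨hφc, hφh, hφ1, -, hφ0, -, hφv⟩ := hφ
  have hxV := interior_subset hx
  have hWc : Convex ℝ W := hW ▸ convex_convexHull ℝ _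
  have hwW : ∀ i, w i ∈ W := fun i => hW ▸ subset_convexHull ℝ _ (mem_range_self i)
  obtain ⟨ℓ, hℓ⟩ := geometric_hahn_banach_open_point hWc.interior isOpen_interior hxW
  set M := ℓ (∑ i ∈ Finset.range n, φ i x • w i) with hM
  have hle : ∀ a ∈ W, ℓ a ≤ M := by
    intro a ha
    have h1 : a ∈ closure (interior W) := by
      rw [hWc.closure_interior_eq_closure_of_nonempty_interior hWi]
      exact subset_closure ha
    exact closure_minimal (fun b hb => (hℓ b hb).le)
      (isClosed_le ℓ.continuous continuous_const) h1
  obtain ⟨j, hj⟩ : ∃ j, ℓ (w j) < M := by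
    by_contra! hcon
    obtain ⟨a, ha⟩ := hWi
    have h1 : W ⊆ {z | M ≤ ℓ z} := by
      rw [hW]
      refine convexHull_min ?_ (convex_halfSpace_ge ℓ.isLinear M)
      rintro _ ⟨i, rfl⟩
      exact hcon i
    exact absurd (hℓ a ha) (not_lt.2 (h1 (interior_subset ha)))
  have hjn : j % n < n := Nat.mod_lt _ hn
  rw [← Function.Periodic.map_mod_nat (f := w) hw j] at hj
  generalize j % n = i at hj hjn
  have hsum : ∑ k ∈ Finset.range n, φ k x * (M - ℓ (w k)) = 0 := by
    simp only [mul_sub, Finset.sum_sub_distrib, ← Finset.sum_mul, hφ1 x hxV, one_mul]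
    rw [hM, map_sum]
    simp
  have hterm := (Finset.sum_eq_zero_iff_of_nonneg fun k _ =>
    mul_nonneg (hφ0 k x hxV) (sub_nonneg.2 (hle _ (hwW k)))).1 hsum i (Finset.mem_range.2 hjn)
  have hzero : φ i x = 0 := (mul_eq_zero.1 hterm).resolve_right (sub_pos.2 hj).ne'
  have h1 := (hφh i).eq_zero_of_nonneg isOpen_interior hU (hVcl ▸ hφc i)
    (fun z hz => hφ0 i z (interior_subset hz)) hx hzero (v i) (hVcl ▸ hvV i hjn)
  rw [hφv i i hjn hjn, if_pos rfl] at h1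
  exact one_ne_zero h1

theorem surjective_of_comp_ne_zero {A : ℝ × ℝ →L[ℝ] ℝ × ℝ}
    (hA : ∀ ℓ : ℝ × ℝ →L[ℝ] ℝ, ℓ ≠ 0 → ℓ ∘SL A ≠ 0) : Function.Surjective A := by
  by_contra hs
  have hlt : LinearMap.range (A : ℝ × ℝ →ₗ[ℝ] ℝ × ℝ) < ⊤ :=
    lt_top_iff_ne_top.2 fun h => hs (LinearMap.range_eq_top.1 h)
  obtain ⟨f, hf, hle⟩ := Submodule.exists_le_ker_of_lt_top _ hlt
  refine hA f.toContinuousLinearMap (by simpa using hf) (ContinuousLinearMap.ext fun p => ?_)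
  have := hle (LinearMap.mem_range_self (A : ℝ × ℝ →ₗ[ℝ] ℝ × ℝ) p)
  simpa using this

theorem jacDet_ne_zero_of_surjective {F : ℝ × ℝ → ℝ × ℝ} {x : ℝ × ℝ}
    (hs : Function.Surjective (fderiv ℝ F x)) : jacDet F x ≠ 0 := by
  intro h0
  have hdec : ∀ p : ℝ × ℝ,
      fderiv ℝ F x p = p.1 • fderiv ℝ F x (1, 0) + p.2 • fderiv ℝ F x (0, 1) := by
    intro p
    rw [← map_smul, ← map_smul, ← map_add]
    congr 1
    ext <;> simp
  obtain ⟨p, hp⟩ := hs (1, 0)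
  obtain ⟨q, hq⟩ := hs (0, 1)
  rw [hdec, Prod.ext_iff] at hp hq
  simp only [Prod.fst_add, Prod.snd_add, Prod.smul_fst, Prod.smul_snd, smul_eq_mul] at hp hq
  obtain ⟨hp1, hp2⟩ := hp
  obtain ⟨hq1, hq2⟩ := hq
  rw [jacDet] at h0
  set a := (fderiv ℝ F x (1, 0)).1
  set b := (fderiv ℝ F x (1, 0)).2
  set c := (fderiv ℝ F x (0, 1)).1
  set d := (fderiv ℝ F x (0, 1)).2
  have h1 : (p.1 * q.2 - p.2 * q.1) * (a * d - c * b) =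
      (p.1 * a + p.2 * c) * (q.1 * b + q.2 * d) - (p.1 * b + p.2 * d) * (q.1 * a + q.2 * c) := by
    ring
  rw [h0, hp1, hp2, hq1, hq2] at h1
  norm_num at h1

/-- The harmonic GBC map from a simple polygon `V` to a convex polygon `W`
(both with vertices counterclockwise), restricted to the interior of `V`, is a smooth
diffeomorphism onto the interior of `W`: it is smooth, a bijection from `int V` onto `int W`,
has nonvanishing Jacobian determinant on `int V`, and admits a smooth inverse. -/
theorem harmonic_gbc_map_diffeomorphism (n : ℕ) (v w : ℕ → ℝ × ℝ) (V W : Set (ℝ × ℝ))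
    (φ : ℕ → (ℝ × ℝ) → ℝ) (hV : IsSimplePolygonCCW V n v) (hφ : IsHarmonicGBC n v V φ)
    (hW : IsConvexPolygonCCW W n w) :
    ∀ F : (ℝ × ℝ) → ℝ × ℝ, (∀ x, F x = ∑ i ∈ Finset.range n, φ i x • w i) →
      ContDiffOn ℝ (⊤ : ℕ∞) F (interior V) ∧
      Set.BijOn F (interior V) (interior W) ∧
      (∀ x ∈ interior V, jacDet F x ≠ 0) ∧
      ∃ G : (ℝ × ℝ) → ℝ × ℝ, ContDiffOn ℝ (⊤ : ℕ∞) G (interior W) ∧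
        (∀ y ∈ interior W, F (G y) = y) ∧ (∀ x ∈ interior V, G (F x) = x) := by
  obtain ⟨hn, hv, hVc, hVcl, hUne, γ, hγ⟩ := hV
  obtain ⟨hw, hWhull, δ, hδ⟩ := hW
  intro F hFdef
  have hF : F = fun x => ∑ i ∈ Finset.range n, φ i x • w i := funext hFdef
  have hn0 : 0 < n := by lia
  obtain ⟨hφc, hφh, -⟩ := id hφ
  have hbdry : ∀ t, 0 ≤ t → F (γ t) = δ t := fun t ht => by
    rw [hFdef]
    exact hφ.sum_smul_boundary hn0 hv hw hγ hδ ht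
  have hγV : ∀ t ∈ Ico (0 : ℝ) 1, γ t ∈ V := fun t ht =>
    hVc.isClosed.frontier_subset (hγ.1.2.2.2.1 ▸ mem_image_of_mem γ ht)
  have hvV : ∀ i < n, v i ∈ V := by
    intro i hi
    have h := hγ.2 i 0 (by simp)
    simp only [add_zero, sub_zero, one_smul, zero_smul] at h
    have hn' : (0 : ℝ) < n := by exact_mod_cast hn0
    rw [← h]
    exact hγV _ ⟨by positivity, by rw [div_lt_one hn']; exact_mod_cast hi⟩
  have hWconv : Convex ℝ W := hWhull ▸ convex_convexHull ℝ _
  have hWcpt : IsCompact W := by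
    rw [hWhull]
    suffices hfin : (range w).Finite from hfin.isCompact_convexHull ℝ
    refine ((Finset.range n).finite_toSet.image w).subset ?_
    rintro _ ⟨j, rfl⟩
    exact ⟨j % n, by simpa using Nat.mod_lt _ hn0, Function.Periodic.map_mod_nat hw j⟩
  have hδ1 : δ 1 = δ 0 := by simpa using hδ.1.2.1 0
  have hδW : ∀ t ∈ Ico (0 : ℝ) 1, δ t ∈ W := fun t ht =>
    hWcpt.isClosed.frontier_subset (hδ.1.2.2.2.1 ▸ mem_image_of_mem δ ht)
  have hWi : (interior W).Nonempty := by
    by_contra hemp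
    obtain ⟨ℓ, hℓ, c, hc⟩ := exists_linear_eq_const_of_interior_eq_empty hWconv
      ⟨_, hδW 0 (by simp)⟩ hemp
    exact not_loop_subset_line hδ.1.1 hδ1 hδ.1.2.2.1 hℓ fun t ht => hc _ (hδW t ht)
  have hU : IsPreconnected (interior V) := hγ.1.isPreconnected_interior hVc
  have hmaps : MapsTo F (interior V) (interior W) :=
    hF ▸ hφ.mapsTo_interior hVcl hU hvV hn0 hw hWhull hWi
  have hFc : ContinuousOn F V :=
    hF ▸ continuousOn_finsetSum _ fun i _ => (hφc i).smul continuousOn_const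
  have hFs : ∀ x ∈ interior V, ContDiffAt ℝ (⊤ : ℕ∞) F x := fun x hx =>
    hF ▸ ContDiffAt.sum fun i _ => ((hφh i).contDiffAt isOpen_interior hx).smul contDiffAt_const
  have hbij : BijOn F (frontier V) (frontier W) :=
    bijOn_frontier_of_comp_eq hγ.1 hδ.1 fun t ht => hbdry t ht.1
  have hharm : ∀ ℓ : ℝ × ℝ →L[ℝ] ℝ, InnerProductSpace.HarmonicOnNhd
      ((ℓ ∘ F) ∘ Complex.equivRealProdCLM) (Complex.equivRealProdCLM ⁻¹' interior V) := by
    intro ℓ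
    have h := harmonicOnNhd_finset_sum (s := Finset.range n) fun i _ =>
      ((hφh i).harmonicOnNhd isOpen_interior).const_smul (c := ℓ (w i))
    convert h using 1
    funext z
    simp [hF, mul_comm]
  have hn1 : ((⊤ : ℕ∞) : WithTop ℕ∞) ≠ 0 := by simp
  have hsurj : ∀ x ∈ interior V, Function.Surjective (fderiv ℝ F x) := fun x hx =>
    surjective_of_comp_ne_zero fun ℓ hℓ => fderiv_comp_ne_zero_of_bijOn_frontier hVc hU hVcl hWconv
      hWcpt hFc hharm hbij hmaps
      (fun c hc => not_loop_subset_line hδ.1.1 hδ1 hδ.1.2.2.1 hℓ (c := c) fun t ht => by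
        rw [← hbdry t ht.1]
        exact hc _ (hγV t ht)) hx ((hFs x hx).differentiableAt hn1)
  have hequiv : ∀ x ∈ interior V, ∃ A : (ℝ × ℝ) ≃L[ℝ] ℝ × ℝ,
      HasFDerivAt F (A : ℝ × ℝ →L[ℝ] ℝ × ℝ) x := by
    intro x hx
    have hinj : Function.Injective (fderiv ℝ F x : ℝ × ℝ →ₗ[ℝ] ℝ × ℝ) :=
      LinearMap.injective_iff_surjective.2 (hsurj x hx)
    refine ⟨(LinearEquiv.ofInjectiveEndo _ hinj).toContinuousLinearEquiv, ?_⟩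
    have hA : ((LinearEquiv.ofInjectiveEndo _ hinj).toContinuousLinearEquiv :
        ℝ × ℝ →L[ℝ] ℝ × ℝ) = fderiv ℝ F x := by
      ext <;> simp
    rw [hA]
    exact ((hFs x hx).differentiableAt hn1).hasFDerivAt
  have hbijI : BijOn F (interior V) (interior W) := by
    refine bijOn_of_isLocalHomeomorphOn hVc isOpen_interior interior_subset hU hUne isOpen_interior
      (hWconv.interior.isSimplyConnected_of_nonempty hWi) hFc hmaps (fun x hx hFx => ?_)
      (isLocalHomeomorphOn_of_contDiffAt hn1 hFs hequiv)
    by_contra hxU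
    exact (hbij.mapsTo ⟨subset_closure hx, hxU⟩).2 hFx
  exact ⟨fun x hx => (hFs x hx).contDiffWithinAt, hbijI,
    fun x hx => jacDet_ne_zero_of_surjective (hsurj x hx),
    exists_contDiffOn_inverse hn1 isOpen_interior hbijI hFs hequiv⟩
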